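/- Let c₁, c₂, c₃ be real numbers such that ρ(c₁,c₂,c₃) is positive semidefinite, set c := max(|c₁|, |c₂|), assume |c₃| ≤ c, and let q₁ := 2 / (2 + c + √(c² + 4(c − c₃))). Then the symmetric local amplitude damping channel with parameter p_opt := 1 − q₁ is optimal among all such channels: for every p ∈ [0,1], F_RSP(Φ_p(ρ(c₁,c₂,c₃))) ≤ max{ F_RSP(ρ(c₁,c₂,c₃)), F_RSP(Φ_{p_opt}(ρ(c₁,c₂,c₃))) }. -/

import Mathlib

open Matrix Kronecker ComplexOrder

noncomputable section

def pauli : Fin 3 → Matrix (Fin 2) (Fin 2) ℂ :=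
  ![!![0, 1; 1, 0], !![0, -Complex.I; Complex.I, 0], !![1, 0; 0, -1]]

def corr (ρ : Matrix (Fin 2 × Fin 2) (Fin 2 × Fin 2) ℂ) : Matrix (Fin 3) (Fin 3) ℝ :=
  Matrix.of fun k l => (Matrix.trace (ρ * (pauli k ⊗ₖ pauli l))).re

def lambdaMax (M : Matrix (Fin 3) (Fin 3) ℝ) : ℝ :=
  sSup {x : ℝ | ∃ v : Fin 3 → ℝ, v ≠ 0 ∧ M.mulVec v = x • v}

def Frsp (ρ : Matrix (Fin 2 × Fin 2) (Fin 2 × Fin 2) ℂ) : ℝ :=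
  (1 / 2) * (Matrix.trace ((corr ρ)ᵀ * corr ρ) - lambdaMax ((corr ρ)ᵀ * corr ρ))

def damp (p : ℝ) : Fin 2 → Matrix (Fin 2) (Fin 2) ℂ :=
  ![!![1, 0; 0, (Real.sqrt (1 - p) : ℂ)], !![0, (Real.sqrt p : ℂ); 0, 0]]

def Phi (p : ℝ) (ρ : Matrix (Fin 2 × Fin 2) (Fin 2 × Fin 2) ℂ) :
    Matrix (Fin 2 × Fin 2) (Fin 2 × Fin 2) ℂ :=
  ∑ i : Fin 2, ∑ j : Fin 2, (damp p i ⊗ₖ damp p j) * ρ * (damp p i ⊗ₖ damp p j)ᴴ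

def bellDiag (c₁ c₂ c₃ : ℝ) : Matrix (Fin 2 × Fin 2) (Fin 2 × Fin 2) ℂ :=
  (1 / 4 : ℂ) • (1 + (c₁ : ℂ) • (pauli 0 ⊗ₖ pauli 0) + (c₂ : ℂ) • (pauli 1 ⊗ₖ pauli 1)
    + (c₃ : ℂ) • (pauli 2 ⊗ₖ pauli 2))

def bloch (ρ : Matrix (Fin 2 × Fin 2) (Fin 2 × Fin 2) ℂ) : Fin 3 → ℝ :=
  fun k => (Matrix.trace (ρ * (pauli k ⊗ₖ (1 : Matrix (Fin 2) (Fin 2) ℂ)))).re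

def Dg (ρ : Matrix (Fin 2 × Fin 2) (Fin 2 × Fin 2) ℂ) : ℝ :=
  (1 / 2) * ((∑ k, bloch ρ k ^ 2) + Matrix.trace (corr ρ * (corr ρ)ᵀ)
    - lambdaMax (Matrix.vecMulVec (bloch ρ) (bloch ρ) + corr ρ * (corr ρ)ᵀ))


lemma lambdaMax_diagonal (d : Fin 3 → ℝ) :
    lambdaMax (Matrix.diagonal d) = max (d 0) (max (d 1) (d 2)) := by
  have h_set : {x : ℝ | ∃ v : Fin 3 → ℝ, v ≠ 0 ∧ (Matrix.diagonal d).mulVec v = x • v} =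
      Set.range d := by
    ext x
    constructor
    · rintro ⟨v, hv, h⟩
      obtain ⟨i, hi⟩ := Function.ne_iff.mp hv
      refine ⟨i, mul_right_cancel₀ hi ?_⟩
      simpa [Matrix.mulVec_diagonal] using congrFun h i
    · rintro ⟨i, rfl⟩
      refine ⟨Pi.single i 1, by simp, ?_⟩
      ext j
      rw [Matrix.mulVec_diagonal]
      rcases eq_or_ne j i with rfl | h <;> simp [*]
  rw [lambdaMax, h_set]
  refine IsLUB.csSup_eq ⟨?_, ?_⟩ (Set.range_nonempty d)
  · rintro _ ⟨i, rfl⟩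
    fin_cases i <;> simp
  · intro b hb
    exact max_le (hb ⟨0, rfl⟩) (max_le (hb ⟨1, rfl⟩) (hb ⟨2, rfl⟩))

lemma Frsp_of_corr_eq_diagonal {ρ : Matrix (Fin 2 × Fin 2) (Fin 2 × Fin 2) ℂ} {x y z : ℝ}
    (h : corr ρ = Matrix.diagonal ![x, y, z]) :
    Frsp ρ = (x ^ 2 + y ^ 2 + z ^ 2 - max (x ^ 2) (max (y ^ 2) (z ^ 2))) / 2 := by
  rw [Frsp, h, Matrix.diagonal_transpose, Matrix.diagonal_mul_diagonal, lambdaMax_diagonal,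
    Matrix.trace_diagonal, Fin.sum_univ_three]
  simp only [Matrix.cons_val, ← pow_two]
  ring

/-- The single-qubit amplitude damping channel. -/
def dampChannel (p : ℝ) (A : Matrix (Fin 2) (Fin 2) ℂ) : Matrix (Fin 2) (Fin 2) ℂ :=
  ∑ i : Fin 2, damp p i * A * (damp p i)ᴴ

lemma Phi_kronecker (p : ℝ) (A B : Matrix (Fin 2) (Fin 2) ℂ) :
    Phi p (A ⊗ₖ B) = dampChannel p A ⊗ₖ dampChannel p B := by
  simp only [Phi, dampChannel, Matrix.conjTranspose_kronecker, ← Matrix.mul_kronecker_mul,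
    Fin.sum_univ_two, Matrix.add_kronecker, Matrix.kronecker_add]
  abel

lemma Phi_add (p : ℝ) (ρ τ : Matrix (Fin 2 × Fin 2) (Fin 2 × Fin 2) ℂ) :
    Phi p (ρ + τ) = Phi p ρ + Phi p τ := by
  simp only [Phi, mul_add, add_mul, Finset.sum_add_distrib]

lemma Phi_smul (p : ℝ) (a : ℂ) (ρ : Matrix (Fin 2 × Fin 2) (Fin 2 × Fin 2) ℂ) :
    Phi p (a • ρ) = a • Phi p ρ := by
  simp only [Phi, Matrix.mul_smul, Matrix.smul_mul, Finset.smul_sum]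

lemma trace_kronecker_mul_kronecker (A B C D : Matrix (Fin 2) (Fin 2) ℂ) :
    ((A ⊗ₖ B) * (C ⊗ₖ D)).trace = (A * C).trace * (B * D).trace := by
  rw [← Matrix.mul_kronecker_mul, Matrix.trace_kronecker]

lemma dampChannel_of {p : ℝ} (hp : p ∈ Set.Icc (0 : ℝ) 1) (a b c d : ℂ) :
    dampChannel p !![a, b; c, d] =
      !![a + p * d, Real.sqrt (1 - p) * b; Real.sqrt (1 - p) * c, (1 - p) * d] := by
  have h₀ : (Real.sqrt p : ℂ) * Real.sqrt p = p := by
    exact_mod_cast Real.mul_self_sqrt hp.1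
  have h₁ : (Real.sqrt (1 - p) : ℂ) * Real.sqrt (1 - p) = 1 - p := by
    exact_mod_cast Real.mul_self_sqrt (sub_nonneg.2 hp.2)
  have h_adj₀ : (damp p 0)ᴴ = !![1, 0; 0, (Real.sqrt (1 - p) : ℂ)] := by
    ext i j
    fin_cases i <;> fin_cases j <;> simp [damp, Matrix.conjTranspose_apply]
  have h_adj₁ : (damp p 1)ᴴ = !![0, 0; (Real.sqrt p : ℂ), 0] := by
    ext i j
    fin_cases i <;> fin_cases j <;> simp [damp, Matrix.conjTranspose_apply]
  rw [dampChannel, Fin.sum_univ_two, h_adj₀, h_adj₁]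
  simp [damp, mul_comm b, mul_right_comm _ d, h₀, h₁]

lemma trace_dampChannel_one_mul_pauli {p : ℝ} (hp : p ∈ Set.Icc (0 : ℝ) 1) (k : Fin 3) :
    (dampChannel p 1 * pauli k).trace = ![(0 : ℂ), 0, 2 * p] k := by
  rw [Matrix.one_fin_two, dampChannel_of hp]
  fin_cases k <;> simp [pauli, Matrix.trace_fin_two]
  ring

lemma trace_dampChannel_pauli_mul_pauli {p : ℝ} (hp : p ∈ Set.Icc (0 : ℝ) 1) (k l : Fin 3) :
    (dampChannel p (pauli k) * pauli l).trace =
      Matrix.diagonal ![2 * (Real.sqrt (1 - p) : ℂ), 2 * Real.sqrt (1 - p), 2 * (1 - p)] k l := by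
  fin_cases k <;> fin_cases l <;>
    simp [pauli, dampChannel_of hp, Matrix.trace_fin_two, mul_assoc] <;> ring

lemma corr_Phi_bellDiag {p : ℝ} (hp : p ∈ Set.Icc (0 : ℝ) 1) (c₁ c₂ c₃ : ℝ) :
    corr (Phi p (bellDiag c₁ c₂ c₃)) =
      Matrix.diagonal ![(1 - p) * c₁, (1 - p) * c₂, p ^ 2 + (1 - p) ^ 2 * c₃] := by
  have h₁ : (Real.sqrt (1 - p) : ℂ) * Real.sqrt (1 - p) = 1 - p := by
    exact_mod_cast Real.mul_self_sqrt (sub_nonneg.2 hp.2)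
  have h_entry (k l : Fin 3) : (Phi p (bellDiag c₁ c₂ c₃) * (pauli k ⊗ₖ pauli l)).trace =
      ((Matrix.diagonal ![(1 - p) * c₁, (1 - p) * c₂, p ^ 2 + (1 - p) ^ 2 * c₃] k l : ℝ) : ℂ) := by
    simp only [bellDiag, ← Matrix.one_kronecker_one, Phi_smul, Phi_add, Phi_kronecker, add_mul,
      Matrix.smul_mul, Matrix.trace_add, Matrix.trace_smul, trace_kronecker_mul_kronecker,
      trace_dampChannel_one_mul_pauli hp, trace_dampChannel_pauli_mul_pauli hp]
    fin_cases k <;> fin_cases l <;> simp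
    · linear_combination c₁ * h₁
    · linear_combination c₂ * h₁
    · ring
  ext k l
  simp [corr, h_entry]

lemma Phi_zero (ρ : Matrix (Fin 2 × Fin 2) (Fin 2 × Fin 2) ℂ) : Phi 0 ρ = ρ := by
  have h₀ : damp 0 0 = 1 := by
    simp [damp, Matrix.one_fin_two]
  have h₁ : damp 0 1 = 0 := by
    ext i j
    fin_cases i <;> fin_cases j <;> simp [damp]
  simp [Phi, Fin.sum_univ_two, h₀, h₁]

lemma neg_one_le_of_posSemidef_bellDiag {c₁ c₂ c₃ : ℝ} (h : (bellDiag c₁ c₂ c₃).PosSemidef) :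
    -1 ≤ c₃ := by
  have h_entry : bellDiag c₁ c₂ c₃ (0, 0) (0, 0) = (((1 + c₃) / 4 : ℝ) : ℂ) := by
    simp [bellDiag, pauli]
    ring
  have h_nonneg := h.diag_nonneg (i := (0, 0))
  rw [h_entry, Complex.zero_le_real] at h_nonneg
  linarith

/-- The RSP-fidelity of the damped Bell-diagonal state, with `q = 1 - p`. -/
def dampedFidelity (b c c₃ q : ℝ) : ℝ :=
  ((q * b) ^ 2 + min ((q * c) ^ 2) (((1 - q) ^ 2 + q ^ 2 * c₃) ^ 2)) / 2

lemma Frsp_Phi_bellDiag {q : ℝ} (hq : q ∈ Set.Icc (0 : ℝ) 1) (c₁ c₂ c₃ : ℝ) :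
    Frsp (Phi (1 - q) (bellDiag c₁ c₂ c₃)) =
      dampedFidelity (min |c₁| |c₂|) (max |c₁| |c₂|) c₃ q := by
  have hp : 1 - q ∈ Set.Icc (0 : ℝ) 1 := ⟨by linarith [hq.2], by linarith [hq.1]⟩
  rw [Frsp_of_corr_eq_diagonal (corr_Phi_bellDiag hp c₁ c₂ c₃), dampedFidelity, sub_sub_cancel]
  congr 1
  generalize (1 - q) ^ 2 + q ^ 2 * c₃ = z
  have hq_sq := sq_nonneg q
  rcases le_total |c₁| |c₂| with h | h
  · have h_sq : (q * c₁) ^ 2 ≤ (q * c₂) ^ 2 := by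
      rw [mul_pow, mul_pow]
      exact mul_le_mul_of_nonneg_left (sq_le_sq.2 h) hq_sq
    rw [min_eq_left h, max_eq_right h, mul_pow q |c₁|, mul_pow q |c₂|, sq_abs, sq_abs,
      ← mul_pow, ← mul_pow]
    rw [max_eq_right (h_sq.trans (le_max_left _ _))]
    linarith [min_add_max ((q * c₂) ^ 2) (z ^ 2)]
  · have h_sq : (q * c₂) ^ 2 ≤ (q * c₁) ^ 2 := by
      rw [mul_pow, mul_pow]
      exact mul_le_mul_of_nonneg_left (sq_le_sq.2 h) hq_sq
    rw [min_eq_right h, max_eq_left h, mul_pow q |c₁|, mul_pow q |c₂|, sq_abs, sq_abs,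
      ← mul_pow, ← mul_pow]
    rw [← max_assoc, max_eq_left h_sq]
    linarith [min_add_max ((q * c₁) ^ 2) (z ^ 2)]

/-- At `q₁` the two largest correlations coincide. -/
lemma crossing_of_eq {c c₃ q₁ : ℝ} (hc : |c₃| ≤ c)
    (hq₁ : q₁ = 2 / (2 + c + Real.sqrt (c ^ 2 + 4 * (c - c₃)))) :
    q₁ ∈ Set.Icc (0 : ℝ) 1 ∧ (1 - q₁) ^ 2 + q₁ ^ 2 * c₃ = q₁ * c := by
  have hc_nonneg : 0 ≤ c := (abs_nonneg c₃).trans hc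
  have h_disc : 0 ≤ c ^ 2 + 4 * (c - c₃) := by nlinarith [le_abs_self c₃, sq_nonneg c]
  have hs := Real.sqrt_nonneg (c ^ 2 + 4 * (c - c₃))
  have hs_sq := Real.sq_sqrt h_disc
  set s := Real.sqrt (c ^ 2 + 4 * (c - c₃))
  have h_pos : 0 < 2 + c + s := by linarith
  refine ⟨⟨?_, ?_⟩, ?_⟩
  · rw [hq₁]; positivity
  · rw [hq₁, div_le_one h_pos]; linarith
  · rw [hq₁]
    field_simp
    linear_combination hs_sq

lemma dampedFidelity_le_max {b c c₃ q q₁ : ℝ} (h_one : -1 ≤ c₃) (hc : |c₃| ≤ c)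
    (hq : q ∈ Set.Icc (0 : ℝ) 1) (hq₁ : q₁ ∈ Set.Icc (0 : ℝ) 1)
    (h_cross : (1 - q₁) ^ 2 + q₁ ^ 2 * c₃ = q₁ * c) :
    dampedFidelity b c c₃ q ≤ max (dampedFidelity b c c₃ 1) (dampedFidelity b c c₃ q₁) := by
  obtain ⟨hq_nonneg, hq_le⟩ := hq
  obtain ⟨hq₁_nonneg, hq₁_le⟩ := hq₁
  have hc_nonneg : 0 ≤ c := (abs_nonneg c₃).trans hc
  have h_at_one : dampedFidelity b c c₃ 1 = (b ^ 2 + c₃ ^ 2) / 2 := by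
    have h_sq : c₃ ^ 2 ≤ c ^ 2 := sq_le_sq.2 (hc.trans (le_abs_self c))
    simp [dampedFidelity, h_sq]
  have h_at_crossing : dampedFidelity b c c₃ q₁ = ((q₁ * b) ^ 2 + (q₁ * c) ^ 2) / 2 := by
    rw [dampedFidelity, h_cross, min_self]
  rw [h_at_one, h_at_crossing]
  rcases le_total q q₁ with h | h
  · refine le_max_of_le_right ?_
    have h_sq : q ^ 2 ≤ q₁ ^ 2 := pow_le_pow_left₀ hq_nonneg h 2
    have h_min := min_le_left ((q * c) ^ 2) (((1 - q) ^ 2 + q ^ 2 * c₃) ^ 2)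
    rw [dampedFidelity]
    nlinarith [mul_le_mul_of_nonneg_right h_sq (sq_nonneg b),
      mul_le_mul_of_nonneg_right h_sq (sq_nonneg c)]
  · have h_min := min_le_right ((q * c) ^ 2) (((1 - q) ^ 2 + q ^ 2 * c₃) ^ 2)
    rw [dampedFidelity]
    rcases le_total 0 ((1 - q) ^ 2 + q ^ 2 * c₃) with hz | hz
    · obtain ⟨s, t, hs, ht, hst, h_comb⟩ : q ∈ segment ℝ q₁ 1 := by
        rw [segment_eq_Icc hq₁_le]; exact ⟨h, hq_le⟩
      obtain rfl : s = 1 - t := by linarith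
      simp only [smul_eq_mul, mul_one] at h_comb
      have h_convex : (1 - q) ^ 2 + q ^ 2 * c₃ ≤ (1 - t) * (q₁ * c) + t * |c₃| := by
        have h_gap : 0 ≤ (1 - t) * t * (1 + c₃) * (1 - q₁) ^ 2 :=
          mul_nonneg (mul_nonneg (mul_nonneg hs ht) (by linarith)) (sq_nonneg _)
        have h_abs := mul_le_mul_of_nonneg_left (le_abs_self c₃) ht
        have h_identity : (1 - q) ^ 2 + q ^ 2 * c₃ + (1 - t) * t * (1 + c₃) * (1 - q₁) ^ 2 =
            (1 - t) * (q₁ * c) + t * c₃ := by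
          rw [← h_cross, ← h_comb]; ring
        linarith
      have hz_sq := pow_le_pow_left₀ hz h_convex 2
      have h_jensen (x y : ℝ) :
          ((1 - t) * x + t * y) ^ 2 ≤ (1 - t) * x ^ 2 + t * y ^ 2 := by
        nlinarith [mul_nonneg (mul_nonneg hs ht) (sq_nonneg (x - y))]
      have hz_jensen := h_jensen (q₁ * c) |c₃|
      have hq_jensen := h_jensen (q₁ * b) b
      rw [sq_abs] at hz_jensen
      have hqb : q * b = (1 - t) * (q₁ * b) + t * b := by rw [← h_comb]; ring
      rw [hqb]
      have h_left := mul_le_mul_of_nonneg_left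
        (le_max_left ((b ^ 2 + c₃ ^ 2) / 2) (((q₁ * b) ^ 2 + (q₁ * c) ^ 2) / 2)) ht
      have h_right := mul_le_mul_of_nonneg_left
        (le_max_right ((b ^ 2 + c₃ ^ 2) / 2) (((q₁ * b) ^ 2 + (q₁ * c) ^ 2) / 2)) hs
      linarith
    · refine le_max_of_le_left ?_
      have hq_sq : q ^ 2 ≤ 1 := pow_le_one₀ hq_nonneg hq_le
      have hz_sq : ((1 - q) ^ 2 + q ^ 2 * c₃) ^ 2 ≤ (q ^ 2 * c₃) ^ 2 := by
        nlinarith [sq_nonneg (1 - q), mul_nonneg (sq_nonneg (1 - q)) (neg_nonneg.2 hz),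
          mul_nonneg (sq_nonneg (1 - q)) (sq_nonneg (1 - q))]
      have h_scale : (q ^ 2 * c₃) ^ 2 ≤ c₃ ^ 2 := by
        rw [mul_pow]
        exact mul_le_of_le_one_left (sq_nonneg _) (pow_le_one₀ (sq_nonneg q) hq_sq)
      nlinarith [mul_le_mul_of_nonneg_right hq_sq (sq_nonneg b)]

/-- Optimality of the damping parameter p_opt = 1 − q₁: no symmetric local amplitude
damping channel beats both the original state and the optimally damped one. -/
theorem optimal_damping_parameter
    (c₁ c₂ c₃ : ℝ) (hpsd : (bellDiag c₁ c₂ c₃).PosSemidef)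
    (c : ℝ) (hc : c = max |c₁| |c₂|) (hc₃ : |c₃| ≤ c)
    (q₁ : ℝ) (hq₁ : q₁ = 2 / (2 + c + Real.sqrt (c ^ 2 + 4 * (c - c₃)))) :
    ∀ p ∈ Set.Icc (0 : ℝ) 1,
      Frsp (Phi p (bellDiag c₁ c₂ c₃)) ≤
        max (Frsp (bellDiag c₁ c₂ c₃)) (Frsp (Phi (1 - q₁) (bellDiag c₁ c₂ c₃))) := by
  intro p hp
  have h_one := neg_one_le_of_posSemidef_bellDiag hpsd
  obtain ⟨hq₁_mem, h_cross⟩ := crossing_of_eq hc₃ hq₁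
  have hq : 1 - p ∈ Set.Icc (0 : ℝ) 1 := ⟨by linarith [hp.2], by linarith [hp.1]⟩
  have h_damped := Frsp_Phi_bellDiag hq c₁ c₂ c₃
  have h_undamped := Frsp_Phi_bellDiag (Set.right_mem_Icc.2 zero_le_one) c₁ c₂ c₃
  rw [sub_sub_cancel] at h_damped
  rw [sub_self, Phi_zero] at h_undamped
  rw [h_damped, h_undamped, Frsp_Phi_bellDiag hq₁_mem, ← hc]
  exact dampedFidelity_le_max h_one hc₃ hq hq₁_mem h_cross

end
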